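/- Let γ > 0, λ > γ/4, τ₀ > 0, set Ω = √(4λγ − γ²), and let g(t) = (2γ/Ω) e^{−γt/2} sin(Ω t / 2). Then lim_{t→∞} ∫₀ᵗ ∫₀ᵗ ġ(t−s) ġ(t−s′) e^{−|s−s′|/τ₀} ds ds′ = 1 / (λ τ₀ + 1 + γ⁻¹ τ₀⁻¹). -/

import Mathlib

open MeasureTheory intervalIntegral Filter

/-- An explicit antiderivative of `h v * exp (k * v)` when `(g, h)` solves the damped
oscillator system `g' = h`, `h' = -γ h - ω g`. -/
lemma integral_mul_exp_of_damped_oscillator {γ ω k : ℝ} {g h : ℝ → ℝ}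
    (hD : k ^ 2 - γ * k + ω ≠ 0)
    (hg : ∀ x, HasDerivAt g (h x) x) (hh : ∀ x, HasDerivAt h (-γ * h x - ω * g x) x)
    (x y : ℝ) :
    ∫ v in x..y, h v * Real.exp (k * v) =
      Real.exp (k * y) * ((k * h y + ω * g y) / (k ^ 2 - γ * k + ω)) -
        Real.exp (k * x) * ((k * h x + ω * g x) / (k ^ 2 - γ * k + ω)) := by
  have hc : Continuous h := continuous_iff_continuousAt.2 fun x => (hh x).continuousAt
  refine integral_eq_sub_of_hasDerivAt
    (f := fun v => Real.exp (k * v) * ((k * h v + ω * g v) / (k ^ 2 - γ * k + ω)))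
    (fun v _ => ?_) (by apply Continuous.intervalIntegrable; fun_prop)
  have he : HasDerivAt (fun v => Real.exp (k * v)) (Real.exp (k * v) * (k * 1)) v :=
    ((hasDerivAt_id v).const_mul k).exp
  refine (he.mul ((((hh v).const_mul k).add ((hg v).const_mul ω)).div_const
    (k ^ 2 - γ * k + ω))).congr_deriv ?_
  simp only [Pi.add_apply]
  generalize hDe : k ^ 2 - γ * k + ω = D at hD ⊢
  field_simp
  linear_combination h v * hDe

/-- The response of a damped oscillator to a two-sided exponential kernel. -/
lemma integral_mul_exp_neg_abs_of_damped_oscillator {γ ω k : ℝ} {g h : ℝ → ℝ}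
    (hD : k ^ 2 - γ * k + ω ≠ 0) (hD' : k ^ 2 + γ * k + ω ≠ 0)
    (hg : ∀ x, HasDerivAt g (h x) x) (hh : ∀ x, HasDerivAt h (-γ * h x - ω * g x) x)
    {u t : ℝ} (hu : 0 ≤ u) (hut : u ≤ t) :
    ∫ v in (0 : ℝ)..t, h v * Real.exp (-(k * |v - u|)) =
      (k * h u + ω * g u) / (k ^ 2 - γ * k + ω)
        - Real.exp (-k * u) * ((k * h 0 + ω * g 0) / (k ^ 2 - γ * k + ω))
        + Real.exp (k * u) * Real.exp (-k * t) *
          ((-k * h t + ω * g t) / (k ^ 2 + γ * k + ω))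
        - (-k * h u + ω * g u) / (k ^ 2 + γ * k + ω) := by
  have hc : Continuous h := continuous_iff_continuousAt.2 fun x => (hh x).continuousAt
  have hi : ∀ x y, IntervalIntegrable (fun v => h v * Real.exp (-(k * |v - u|))) volume x y :=
    fun x y => by apply Continuous.intervalIntegrable; fun_prop
  have hleft : ∫ v in (0 : ℝ)..u, h v * Real.exp (-(k * |v - u|)) =
      Real.exp (-k * u) * ∫ v in (0 : ℝ)..u, h v * Real.exp (k * v) := by
    rw [← intervalIntegral.integral_const_mul]
    refine integral_congr fun v hv => ?_
    rw [Set.uIcc_of_le hu] at hv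
    rw [abs_of_nonpos (by linarith [hv.2]),
      show -(k * -(v - u)) = -k * u + k * v by ring, Real.exp_add]
    ring
  have hright : ∫ v in u..t, h v * Real.exp (-(k * |v - u|)) =
      Real.exp (k * u) * ∫ v in u..t, h v * Real.exp (-k * v) := by
    rw [← intervalIntegral.integral_const_mul]
    refine integral_congr fun v hv => ?_
    rw [Set.uIcc_of_le hut] at hv
    rw [abs_of_nonneg (by linarith [hv.1]),
      show -(k * (v - u)) = k * u + -k * v by ring, Real.exp_add]
    ring
  have hDneg : (-k) ^ 2 - γ * (-k) + ω = k ^ 2 + γ * k + ω := by ring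
  have hexp : Real.exp (k * u) * Real.exp (-k * u) = 1 := by
    rw [← Real.exp_add]; simp
  rw [← integral_add_adjacent_intervals (hi 0 u) (hi u t), hleft, hright,
    integral_mul_exp_of_damped_oscillator hD hg hh,
    integral_mul_exp_of_damped_oscillator (k := -k) (by rwa [hDneg]) hg hh, hDneg,
    mul_zero, Real.exp_zero]
  linear_combination ((k * h u + ω * g u) / (k ^ 2 - γ * k + ω)
    - (-k * h u + ω * g u) / (k ^ 2 + γ * k + ω)) * hexp

/-- The second moment at time `t` of a damped oscillator driven by exponentially correlated
noise, in closed form. -/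
lemma second_moment_of_damped_oscillator {γ ω k : ℝ} {g h : ℝ → ℝ} (hγ : γ ≠ 0)
    (hD : k ^ 2 - γ * k + ω ≠ 0) (hD' : k ^ 2 + γ * k + ω ≠ 0)
    (hg : ∀ x, HasDerivAt g (h x) x) (hh : ∀ x, HasDerivAt h (-γ * h x - ω * g x) x)
    {t : ℝ} (ht : 0 ≤ t) :
    ∫ u in (0 : ℝ)..t, ∫ v in (0 : ℝ)..t, h u * h v * Real.exp (-(k * |v - u|)) =
      (k / (k ^ 2 - γ * k + ω) + k / (k ^ 2 + γ * k + ω)) *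
          ((h 0 ^ 2 + ω * g 0 ^ 2 - h t ^ 2 - ω * g t ^ 2) / (2 * γ))
        + (ω / (k ^ 2 - γ * k + ω) - ω / (k ^ 2 + γ * k + ω)) * ((g t ^ 2 - g 0 ^ 2) / 2)
        - (k * h 0 + ω * g 0) / (k ^ 2 - γ * k + ω) *
          (Real.exp (-k * t) * ((-k * h t + ω * g t) / (k ^ 2 + γ * k + ω))
            - (-k * h 0 + ω * g 0) / (k ^ 2 + γ * k + ω))
        + (-k * h t + ω * g t) / (k ^ 2 + γ * k + ω) *
          ((k * h t + ω * g t) / (k ^ 2 - γ * k + ω)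
            - Real.exp (-k * t) * ((k * h 0 + ω * g 0) / (k ^ 2 - γ * k + ω))) := by
  have hc : Continuous h := continuous_iff_continuousAt.2 fun x => (hh x).continuousAt
  have hcg : Continuous g := continuous_iff_continuousAt.2 fun x => (hg x).continuousAt
  have hhh : ∫ u in (0 : ℝ)..t, h u ^ 2 =
      -(h t ^ 2 + ω * g t ^ 2) / (2 * γ) - -(h 0 ^ 2 + ω * g 0 ^ 2) / (2 * γ) := by
    refine integral_eq_sub_of_hasDerivAt
      (f := fun u => -(h u ^ 2 + ω * g u ^ 2) / (2 * γ))
      (fun u _ => ?_) (by apply Continuous.intervalIntegrable; fun_prop)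
    refine (((((hh u).pow 2).add (((hg u).pow 2).const_mul ω)).neg).div_const
      (2 * γ)).congr_deriv ?_
    push_cast
    field_simp
    ring
  have hgh : ∫ u in (0 : ℝ)..t, h u * g u = g t ^ 2 / 2 - g 0 ^ 2 / 2 := by
    refine integral_eq_sub_of_hasDerivAt (f := fun u => g u ^ 2 / 2)
      (fun u _ => ?_) (by apply Continuous.intervalIntegrable; fun_prop)
    refine (((hg u).pow 2).div_const 2).congr_deriv ?_
    push_cast
    ring
  have hDneg : (-k) ^ 2 - γ * (-k) + ω = k ^ 2 + γ * k + ω := by ring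
  have hm := integral_mul_exp_of_damped_oscillator (k := -k) (by rwa [hDneg]) hg hh 0 t
  have hp := integral_mul_exp_of_damped_oscillator hD hg hh 0 t
  rw [hDneg] at hm
  have hexp : Real.exp (k * t) * Real.exp (-k * t) = 1 := by
    rw [← Real.exp_add]; simp
  have hsplit : ∫ u in (0 : ℝ)..t, ∫ v in (0 : ℝ)..t, h u * h v * Real.exp (-(k * |v - u|)) =
      ∫ u in (0 : ℝ)..t,
        ((k / (k ^ 2 - γ * k + ω) + k / (k ^ 2 + γ * k + ω)) * h u ^ 2
        + (ω / (k ^ 2 - γ * k + ω) - ω / (k ^ 2 + γ * k + ω)) * (h u * g u)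
        + -((k * h 0 + ω * g 0) / (k ^ 2 - γ * k + ω)) * (h u * Real.exp (-k * u))
        + (Real.exp (-k * t) * ((-k * h t + ω * g t) / (k ^ 2 + γ * k + ω))) *
          (h u * Real.exp (k * u))) := by
    refine integral_congr fun u hu => ?_
    rw [Set.uIcc_of_le ht] at hu
    simp only [mul_assoc]
    rw [intervalIntegral.integral_const_mul,
      integral_mul_exp_neg_abs_of_damped_oscillator hD hD' hg hh hu.1 hu.2]
    ring
  rw [hsplit, intervalIntegral.integral_add, intervalIntegral.integral_add,
    intervalIntegral.integral_add, intervalIntegral.integral_const_mul,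
    intervalIntegral.integral_const_mul, intervalIntegral.integral_const_mul,
    intervalIntegral.integral_const_mul, hhh, hgh, hm, hp]
  · simp only [mul_zero, Real.exp_zero]
    linear_combination ((-k * h t + ω * g t) / (k ^ 2 + γ * k + ω) *
      ((k * h t + ω * g t) / (k ^ 2 - γ * k + ω))) * hexp
  all_goals apply Continuous.intervalIntegrable; fun_prop

/-- A bounded function times a decaying exponential tends to zero. -/
lemma tendsto_exp_neg_mul_of_abs_le {c C : ℝ} (hc : 0 < c) {f : ℝ → ℝ} (hf : ∀ x, |f x| ≤ C) :
    Tendsto (fun t => Real.exp (-c * t) * f t) atTop (nhds 0) := by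
  have he : Tendsto (fun t : ℝ => Real.exp (-c * t)) atTop (nhds 0) :=
    Real.tendsto_exp_atBot.comp (tendsto_id.const_mul_atTop_of_neg (neg_neg_of_pos hc))
  refine squeeze_zero_norm (a := fun t => Real.exp (-c * t) * C) (fun t => ?_)
    (by simpa using he.mul_const C)
  rw [norm_mul, Real.norm_eq_abs, Real.norm_eq_abs, Real.abs_exp]
  exact mul_le_mul_of_nonneg_left (hf t) (Real.exp_pos _).le

/-- core exponential-integral computation in Proposition 2.
For `γ > 0`, `λ > γ/4`, `τ₀ > 0`, `Ω = √(4λγ − γ²)` and the underdamped Green's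
function `g t = (2γ/Ω) e^{−γt/2} sin(Ω t/2)`, the stationary second moment of
the mode frequency driven by exponentially correlated noise is
`lim_{t→∞} ∫₀ᵗ∫₀ᵗ ġ(t−s) ġ(t−s′) e^{−|s−s′|/τ₀} ds ds′
  = 1/(λτ₀ + 1 + γ⁻¹τ₀⁻¹)`. -/
theorem stationary_second_moment
    (γ lam τ₀ : ℝ) (hγ : 0 < γ) (hlam : γ / 4 < lam) (hτ₀ : 0 < τ₀)
    (Ω : ℝ) (hΩ : Ω = Real.sqrt (4 * lam * γ - γ ^ 2))
    (g : ℝ → ℝ)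
    (hg : ∀ t : ℝ, g t = (2 * γ / Ω) * Real.exp (-γ * t / 2) * Real.sin (Ω * t / 2)) :
    Tendsto
      (fun t : ℝ => ∫ s in (0 : ℝ)..t, ∫ s' in (0 : ℝ)..t,
        deriv g (t - s) * deriv g (t - s') * Real.exp (-|s - s'| / τ₀))
      atTop
      (nhds (1 / (lam * τ₀ + 1 + γ⁻¹ * τ₀⁻¹))) := by
  have hpos : 0 < 4 * lam * γ - γ ^ 2 := by nlinarith
  have hΩpos : 0 < Ω := hΩ ▸ Real.sqrt_pos.2 hpos
  have hΩsq : Ω ^ 2 = 4 * lam * γ - γ ^ 2 := by rw [hΩ, Real.sq_sqrt hpos.le]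
  set k : ℝ := τ₀⁻¹ with hkdef
  have hk : 0 < k := inv_pos.2 hτ₀
  set ω : ℝ := γ * lam with hω
  have hlampos : 0 < lam := by linarith
  have hωpos : 0 < ω := mul_pos hγ hlampos
  have hD : 0 < k ^ 2 - γ * k + ω := by nlinarith [sq_nonneg (k - γ / 2)]
  have hD' : 0 < k ^ 2 + γ * k + ω := by positivity
  set h : ℝ → ℝ := fun t => Real.exp (-(γ / 2) * t) *
    (γ * Real.cos (Ω * t / 2) - γ ^ 2 / Ω * Real.sin (Ω * t / 2)) with hh
  have hg' : g = fun t => Real.exp (-(γ / 2) * t) * (2 * γ / Ω * Real.sin (Ω * t / 2)) := by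
    funext t
    rw [hg, show -γ * t / 2 = -(γ / 2) * t by ring]
    ring
  have dexp : ∀ x, HasDerivAt (fun t => Real.exp (-(γ / 2) * t))
      (Real.exp (-(γ / 2) * x) * (-(γ / 2) * 1)) x :=
    fun x => ((hasDerivAt_id x).const_mul _).exp
  have dlin : ∀ x, HasDerivAt (fun t => Ω * t / 2) (Ω * 1 / 2) x :=
    fun x => ((hasDerivAt_id x).const_mul Ω).div_const 2
  have dg : ∀ x, HasDerivAt g (h x) x := fun x => by
    rw [hg']
    refine ((dexp x).mul ((dlin x).sin.const_mul (2 * γ / Ω))).congr_deriv ?_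
    simp only [hh]
    field_simp
    ring
  have dh : ∀ x, HasDerivAt h (-γ * h x - ω * g x) x := fun x => by
    refine ((dexp x).mul (((dlin x).cos.const_mul γ).sub
      ((dlin x).sin.const_mul (γ ^ 2 / Ω)))).congr_deriv ?_
    simp only [hh, hg', hω, Pi.sub_apply]
    field_simp
    linear_combination (-Real.sin (x * Ω / 2)) * hΩsq
  have hderiv : deriv g = h := funext fun x => (dg x).deriv
  have g0 : g 0 = 0 := by simp [hg]
  have h0 : h 0 = γ := by simp [hh]
  have limg : Tendsto g atTop (nhds 0) := by
    rw [hg']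
    refine tendsto_exp_neg_mul_of_abs_le (C := 2 * γ / Ω) (half_pos hγ) fun x => ?_
    rw [abs_mul, abs_of_pos (by positivity : 0 < 2 * γ / Ω)]
    exact mul_le_of_le_one_right (by positivity) (Real.abs_sin_le_one _)
  have limh : Tendsto h atTop (nhds 0) := by
    refine tendsto_exp_neg_mul_of_abs_le (C := γ + γ ^ 2 / Ω) (half_pos hγ) fun x => ?_
    refine (abs_sub _ _).trans (add_le_add ?_ ?_)
    · rw [abs_mul, abs_of_pos hγ]
      exact mul_le_of_le_one_right hγ.le (Real.abs_cos_le_one _)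
    · rw [abs_mul, abs_of_pos (by positivity : 0 < γ ^ 2 / Ω)]
      exact mul_le_of_le_one_right (by positivity) (Real.abs_sin_le_one _)
  have lime : Tendsto (fun t => Real.exp (-k * t)) atTop (nhds 0) := by
    simpa using tendsto_exp_neg_mul_of_abs_le (C := 1) hk (f := fun _ => 1) (by simp)
  have hreflect : ∀ t : ℝ, (∫ s in (0 : ℝ)..t, ∫ s' in (0 : ℝ)..t,
      deriv g (t - s) * deriv g (t - s') * Real.exp (-|s - s'| / τ₀)) =
      ∫ u in (0 : ℝ)..t, ∫ v in (0 : ℝ)..t, h u * h v * Real.exp (-(k * |v - u|)) := by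
    intro t
    have houter := integral_comp_sub_left (a := 0) (b := t)
      (fun u => ∫ v in (0 : ℝ)..t, h u * h v * Real.exp (-(k * |v - u|))) t
    rw [sub_self, sub_zero] at houter
    rw [← houter]
    refine integral_congr fun s _ => ?_
    have hinner := integral_comp_sub_left (a := 0) (b := t)
      (fun v => h (t - s) * h v * Real.exp (-(k * |v - (t - s)|))) t
    rw [sub_self, sub_zero] at hinner
    rw [← hinner, hderiv]
    refine integral_congr fun s' _ => ?_
    rw [show t - s' - (t - s) = s - s' by ring, neg_div, div_eq_inv_mul]
  have hlim := ((((((limh.pow 2).const_sub (γ ^ 2)).sub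
    ((limg.pow 2).const_mul ω)).div_const (2 * γ)).const_mul
      (k / (k ^ 2 - γ * k + ω) + k / (k ^ 2 + γ * k + ω))).add
    (((limg.pow 2).div_const 2).const_mul
      (ω / (k ^ 2 - γ * k + ω) - ω / (k ^ 2 + γ * k + ω)))).sub
    (((lime.mul (((limh.const_mul (-k)).add (limg.const_mul ω)).div_const
      (k ^ 2 + γ * k + ω))).sub_const (-k * γ / (k ^ 2 + γ * k + ω))).const_mul
        (k * γ / (k ^ 2 - γ * k + ω))) |>.add
    ((((limh.const_mul (-k)).add (limg.const_mul ω)).div_const (k ^ 2 + γ * k + ω)).mul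
      ((((limh.const_mul k).add (limg.const_mul ω)).div_const (k ^ 2 - γ * k + ω)).sub
        (lime.mul_const (k * γ / (k ^ 2 - γ * k + ω)))))
  have hval : 1 / (lam * τ₀ + 1 + γ⁻¹ * k) = k * γ / (k ^ 2 + γ * k + ω) := by
    have hτ : τ₀ = k⁻¹ := by rw [hkdef, inv_inv]
    have : lam * τ₀ + 1 + γ⁻¹ * k = (k ^ 2 + γ * k + ω) / (k * γ) := by
      rw [hτ, hω]
      field_simp
      ring
    rw [this, one_div_div]
  rw [hval]
  refine Tendsto.congr' ?_ (hlim.trans_eq ?_)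
  · filter_upwards [eventually_ge_atTop 0] with t ht
    rw [hreflect, second_moment_of_damped_oscillator hγ.ne' hD.ne' hD'.ne' dg dh ht, g0, h0]
    ring
  · congr 1
    have h1 := hD.ne'
    have h2 := hD'.ne'
    have hdiff : (k ^ 2 + γ * k + ω) - (k ^ 2 - γ * k + ω) = 2 * k * γ := by ring
    generalize k ^ 2 - γ * k + ω = D at h1 hdiff ⊢
    generalize k ^ 2 + γ * k + ω = D' at h2 hdiff ⊢
    field_simp
    linear_combination (k * γ ^ 2) * hdiff
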